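/- arXiv:2309.15570 — 6 statements merged into one kernel-verified Lean document; each statement's English description precedes it below -/
import Mathlib

section
/- Let G be a discrete group and let T be a transversal (a set of coset representatives) for FC(G) in G. The weak*-closed two-sided ideals of ℓ¹(G) are exactly the sets ⊕_{t∈T} δ_t * J = {f ∈ ℓ¹(G) : the restriction of δ_{t⁻¹} * f to FC(G) belongs to J for every t ∈ T}, where J ranges over the weak*-closed two-sided ideals of ℓ¹(FC(G)) satisfying δ_s * J * δ_{s⁻¹} = J for all s ∈ G. -/
noncomputable section

open Filter Topology
open scoped Classical ENNReal

/-- Membership in `ℓ¹(G)`: absolutely summable complex-valued functions on `G`. -/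
def MemL1 {G : Type*} (f : G → ℂ) : Prop := Summable fun t => ‖f t‖

/-- Convolution of two functions on a group. -/
def convFn {G : Type*} [Group G] (f g : G → ℂ) : G → ℂ := fun x => ∑' s : G, f s * g (s⁻¹ * x)

/-- `ℓ¹(G)` as a type. -/
def L1 (G : Type*) : Type _ := {f : G → ℂ // MemL1 f}

/-- The predicate of belonging to `c₀(G)`: functions vanishing at infinity on the
discrete group `G`. -/
def MemC0 {G : Type*} (φ : G → ℂ) : Prop := Tendsto φ cofinite (𝓝 0)

/-- The weak*-topology `σ(ℓ¹(G), c₀(G))` on `ℓ¹(G)`, induced by the pairings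
`f ↦ Σ_{t∈G} φ(t) f(t)` with `φ ∈ c₀(G)`. -/
instance L1.topology (G : Type*) : TopologicalSpace (L1 G) :=
  TopologicalSpace.induced
    (fun f : L1 G => fun φ : {φ : G → ℂ // MemC0 φ} => ∑' t : G, φ.1 t * f.1 t)
    inferInstance

/-- A set of elements of `ℓ¹(G)` is weak*-closed. -/
def WStarClosed {G : Type*} (S : Set (G → ℂ)) : Prop := IsClosed {f : L1 G | f.1 ∈ S}

/-- A weak*-closed two-sided ideal of the convolution algebra `ℓ¹(G)`. -/
def IsWStarClosedIdeal {G : Type*} [Group G] (S : Set (G → ℂ)) : Prop :=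
  S ⊆ {f | MemL1 f} ∧ (0 : G → ℂ) ∈ S ∧
  (∀ f ∈ S, ∀ g ∈ S, f + g ∈ S) ∧
  (∀ (c : ℂ), ∀ f ∈ S, c • f ∈ S) ∧
  (∀ f ∈ S, ∀ g : G → ℂ, MemL1 g → convFn g f ∈ S ∧ convFn f g ∈ S) ∧
  WStarClosed S

/-- The point mass `δ_t ∈ ℓ¹(G)`. -/
def delta {G : Type*} (t : G) : G → ℂ := fun x => if x = t then 1 else 0

/-- `f` is supported in the subset `N` of `G`. -/
def SuppIn {G : Type*} (N : Set G) (f : G → ℂ) : Prop := ∀ x, x ∉ N → f x = 0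

/-- `ℓ¹(N)`, identified with the subalgebra of `ℓ¹(G)` of functions supported on `N`. -/
def L1On {G : Type*} (N : Set G) : Set (G → ℂ) := {f | MemL1 f ∧ SuppIn N f}

/-- A two-sided ideal of `ℓ¹(N)` (identified with the functions in `ℓ¹(G)` supported
on `N`). -/
def IsIdealOn {G : Type*} [Group G] (N : Set G) (J : Set (G → ℂ)) : Prop :=
  J ⊆ L1On N ∧ (0 : G → ℂ) ∈ J ∧
  (∀ f ∈ J, ∀ g ∈ J, f + g ∈ J) ∧
  (∀ (c : ℂ), ∀ f ∈ J, c • f ∈ J) ∧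
  (∀ f ∈ J, ∀ g ∈ L1On N, convFn g f ∈ J ∧ convFn f g ∈ J)

/-- The conjugate `f^s = δ_s * f * δ_{s⁻¹}` of `f ∈ ℓ¹(G)` by `s ∈ G`,
so that `f^s (g) = f (s⁻¹ g s)`. -/
def conjFn {G : Type*} [Group G] (s : G) (f : G → ℂ) : G → ℂ := fun g => f (s⁻¹ * g * s)

/-- `J` is invariant under conjugation by elements of `G`:
`δ_s * J * δ_{s⁻¹} = J` for all `s ∈ G`. -/
def GConjInvariant {G : Type*} [Group G] (J : Set (G → ℂ)) : Prop :=
  ∀ s : G, conjFn s '' J = J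

/-- `T` is a transversal (set of coset representatives) for `N` in `G`. -/
def IsTransversal {G : Type*} [Group G] (N : Set G) (T : Set G) : Prop :=
  ∀ g : G, ∃! t : G, t ∈ T ∧ t⁻¹ * g ∈ N

/-- The set `⊕_{t ∈ T} δ_t * J`: those `f ∈ ℓ¹(G)` such that for every `t ∈ T` the
restriction of `δ_{t⁻¹} * f` to `N` belongs to `J`. -/
def bigOplus {G : Type*} [Group G] (N T : Set G) (J : Set (G → ℂ)) : Set (G → ℂ) :=
  {f | MemL1 f ∧ ∀ t ∈ T, N.indicator (convFn (delta t⁻¹) f) ∈ J}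

/-- The FC-centre of `G`: the set of elements with finite conjugacy class. -/
def FCset (G : Type*) [Group G] : Set G := {t : G | {x : G | IsConj t x}.Finite}

section GroupTheory

open scoped Pointwise

variable {G : Type*} [Group G]

/-- The FC-centre as a subgroup. -/
def fcSubgroup (G : Type*) [Group G] : Subgroup G where
  carrier := FCset G
  one_mem' := by
    refine (Set.finite_singleton (1 : G)).subset fun x hx => ?_
    simpa [isConj_iff, eq_comm] using hx
  mul_mem' := by
    intro a b ha hb
    refine (Set.Finite.image2 (· * ·) ha hb).subset fun x hx => ?_
    obtain ⟨c, rfl⟩ := isConj_iff.1 hx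
    exact ⟨c * a * c⁻¹, isConj_iff.2 ⟨c, rfl⟩, c * b * c⁻¹, isConj_iff.2 ⟨c, rfl⟩, by group⟩
  inv_mem' := by
    intro a ha
    refine (Set.Finite.image (·⁻¹) ha).subset fun x hx => ?_
    obtain ⟨c, rfl⟩ := isConj_iff.1 hx
    exact ⟨c * a * c⁻¹, isConj_iff.2 ⟨c, rfl⟩, by group⟩

instance : (fcSubgroup G).Normal where
  conj_mem n hn g := by
    refine Set.Finite.subset hn fun x hx => ?_
    exact (isConj_iff.2 ⟨g, rfl⟩ : IsConj n (g * n * g⁻¹)).trans hx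

theorem mem_FCset_of_finiteIndex_centralizer {x : G}
    (h : (Subgroup.centralizer {x}).FiniteIndex) : x ∈ FCset G := by
  have : Finite (G ⧸ Subgroup.centralizer {x}) := Subgroup.finite_quotient_of_finiteIndex
  refine (Set.finite_range fun q : G ⧸ Subgroup.centralizer {x} =>
    q.out * x * q.out⁻¹).subset fun y hy => ?_
  obtain ⟨c, rfl⟩ := isConj_iff.1 hy
  refine ⟨(c : G ⧸ Subgroup.centralizer {x}), ?_⟩
  obtain ⟨h, hh⟩ := QuotientGroup.mk_out_eq_mul (Subgroup.centralizer {x}) c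
  have h2 : x * (h : G) = h * x := Subgroup.mem_centralizer_singleton_iff.1 h.2 |>.symm
  simp only [hh, mul_inv_rev]
  rw [mul_assoc c, ← h2]
  group

/-- Some element centralises the part of `K` inside the FC-centre and conjugates the rest of `K`
out of `K`. -/
theorem exists_conj_separating (K : Finset G) :
    ∃ s : G, (∀ x ∈ K, x ∈ FCset G → s * x * s⁻¹ = x) ∧
      ∀ x ∈ K, x ∉ FCset G → s * x * s⁻¹ ∉ K := by
  by_contra! hcon
  have hfin : {p : G × G | p.1 ∈ K ∧ IsConj p.1 p.2 ∧
      ((p.1 ∈ FCset G ∧ p.2 ≠ p.1) ∨ (p.1 ∉ FCset G ∧ p.2 ∈ K))}.Finite := by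
    have hc : (⋃ x ∈ {x ∈ K | x ∈ FCset G}, {y : G | IsConj x y}).Finite :=
      Set.Finite.biUnion (Finset.finite_toSet _) fun x hx => (Finset.mem_filter.1 hx).2
    refine (K.finite_toSet.prod (hc.union K.finite_toSet)).subset ?_
    rintro ⟨x, y⟩ ⟨hx, hxy, h | h⟩
    · exact ⟨hx, Or.inl (Set.mem_biUnion (by simpa using ⟨hx, h.1⟩) hxy)⟩
    · exact ⟨hx, Or.inr h.2⟩
  let c : G × G → G := fun p => if h : ∃ c, c * p.1 * c⁻¹ = p.2 then h.choose else 1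
  have hcspec : ∀ p : G × G, IsConj p.1 p.2 → c p * p.1 * (c p)⁻¹ = p.2 := by
    intro p hp
    have h : ∃ c, c * p.1 * c⁻¹ = p.2 := isConj_iff.1 hp
    simp only [c, dif_pos h]
    exact h.choose_spec
  have hmem : ∀ p : G × G, IsConj p.1 p.2 → ∀ s : G,
      s ∈ c p • ((Subgroup.centralizer {p.1} : Subgroup G) : Set G) ↔ s * p.1 * s⁻¹ = p.2 := by
    intro p hp s
    rw [Set.mem_smul_set_iff_inv_smul_mem, smul_eq_mul, SetLike.mem_coe,
      Subgroup.mem_centralizer_singleton_iff]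
    rw [← hcspec p hp]
    constructor
    · intro h
      have h' : s * p.1 = c p * (p.1 * ((c p)⁻¹ * s)) := by rw [← h]; group
      rw [h']; group
    · intro h
      have h' : s * p.1 = c p * p.1 * (c p)⁻¹ * s := by rw [← h]; group
      rw [mul_assoc, h']; group
  have hcover : ⋃ p ∈ hfin.toFinset,
      c p • ((Subgroup.centralizer {p.1} : Subgroup G) : Set G) = Set.univ := by
    refine Set.eq_univ_of_forall fun s => ?_
    have key : ∃ x ∈ K, (x ∈ FCset G ∧ s * x * s⁻¹ ≠ x) ∨
        (x ∉ FCset G ∧ s * x * s⁻¹ ∈ K) := by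
      by_cases h : ∀ x ∈ K, x ∈ FCset G → s * x * s⁻¹ = x
      · obtain ⟨x, hx, hxN, hxK⟩ := hcon s h
        exact ⟨x, hx, Or.inr ⟨hxN, hxK⟩⟩
      · push Not at h
        obtain ⟨x, hx, hxN, hne⟩ := h
        exact ⟨x, hx, Or.inl ⟨hxN, hne⟩⟩
    obtain ⟨x, hx, h⟩ := key
    have hconj : IsConj x (s * x * s⁻¹) := isConj_iff.2 ⟨s, rfl⟩
    refine Set.mem_biUnion (x := (x, s * x * s⁻¹)) ?_ ((hmem _ hconj s).2 rfl)
    exact hfin.mem_toFinset.2 ⟨hx, hconj, h⟩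
  have h1 : (1 : G) ∈ (Set.univ : Set G) := trivial
  rw [← Subgroup.leftCoset_cover_filter_FiniteIndex hcover] at h1
  obtain ⟨p, hp, hp1⟩ := Set.mem_iUnion₂.1 h1
  obtain ⟨hp, hfi⟩ := Finset.mem_filter.1 hp
  obtain ⟨-, hconj, h⟩ := hfin.mem_toFinset.1 hp
  have hN := mem_FCset_of_finiteIndex_centralizer hfi
  have := (hmem p hconj 1).1 hp1
  rcases h with h | h
  · exact h.2 (by simpa using this.symm)
  · exact h.1 hN

end GroupTheory

section WeakStar

variable {G : Type*}

theorem MemL1.comp_injective {f : G → ℂ} (hf : MemL1 f) {e : G → G}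
    (he : Function.Injective e) : MemL1 fun x => f (e x) :=
  Summable.comp_injective (f := fun x => ‖f x‖) hf he

theorem MemL1.of_norm_le {f : G → ℂ} {b : G → ℝ} (hb : Summable b) (h : ∀ x, ‖f x‖ ≤ b x) :
    MemL1 f :=
  Summable.of_nonneg_of_le (fun _ => norm_nonneg _) h hb

theorem MemL1.indicator {f : G → ℂ} (hf : MemL1 f) (N : Set G) : MemL1 (N.indicator f) :=
  MemL1.of_norm_le hf fun x => norm_indicator_le_norm_self f x

theorem MemC0.exists_bound {φ : G → ℂ} (hφ : MemC0 φ) : ∃ C, ∀ x, ‖φ x‖ ≤ C := by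
  obtain ⟨C, hC⟩ := (Tendsto.norm hφ).bddAbove_range_of_cofinite
  exact ⟨C, fun x => hC ⟨x, rfl⟩⟩

theorem MemC0.indicator {φ : G → ℂ} (hφ : MemC0 φ) (N : Set G) : MemC0 (N.indicator φ) :=
  squeeze_zero_norm (fun x => norm_indicator_le_norm_self φ x) (by simpa using Tendsto.norm hφ)

theorem MemC0.comp_injective {φ : G → ℂ} (hφ : MemC0 φ) {e : G → G}
    (he : Function.Injective e) : MemC0 fun x => φ (e x) :=
  Tendsto.comp hφ he.tendsto_cofinite

/-- An element of `L1 G` from an absolutely summable function. -/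
def L1.mk (f : G → ℂ) (hf : MemL1 f) : L1 G := ⟨f, hf⟩

theorem isInducing_L1 (G : Type*) : IsInducing
    (fun f : L1 G => fun φ : {φ : G → ℂ // MemC0 φ} => ∑' t : G, φ.1 t * f.1 t) := ⟨rfl⟩

theorem L1.continuous_pairing {φ : G → ℂ} (hφ : MemC0 φ) :
    Continuous fun f : L1 G => ∑' t, φ t * f.1 t :=
  (continuous_apply (⟨φ, hφ⟩ : {φ : G → ℂ // MemC0 φ})).comp (isInducing_L1 G).continuous

theorem L1.continuous_eval (x : G) : Continuous fun f : L1 G => f.1 x := by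
  have hφ : MemC0 (delta x) := by
    refine tendsto_const_nhds.congr' ?_
    filter_upwards [(Set.finite_singleton x).compl_mem_cofinite] with y hy
    simp only [Set.mem_compl_iff, Set.mem_singleton_iff] at hy
    simp [delta, hy]
  refine (L1.continuous_pairing hφ).congr fun f => ?_
  rw [tsum_eq_single x fun y hy => by simp [delta, hy]]
  simp [delta]

theorem WStarClosed.inter {S S' : Set (G → ℂ)} (h : WStarClosed S) (h' : WStarClosed S') :
    WStarClosed (S ∩ S') := IsClosed.inter h h'

theorem wStarClosed_L1On (N : Set G) : WStarClosed (L1On N) := by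
  have : {f : L1 G | f.1 ∈ L1On N} = ⋂ x ∈ Nᶜ, {f : L1 G | f.1 x = 0} := by
    ext f
    simp only [Set.mem_ofPred_eq, Set.mem_iInter]
    exact ⟨fun h x hx => h.2 x hx, fun h => ⟨f.2, h⟩⟩
  unfold WStarClosed
  rw [this]
  exact isClosed_biInter fun x _ => isClosed_eq (L1.continuous_eval x) continuous_const

theorem WStarClosed.mem_of_tendsto {S : Set (G → ℂ)} (hS : WStarClosed S) {ι : Type*}
    {l : Filter ι} [NeBot l] {F : ι → G → ℂ} {g : G → ℂ} (hg : MemL1 g)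
    (hF1 : ∀ i, MemL1 (F i)) (hF : ∀ i, F i ∈ S)
    (h : ∀ φ, MemC0 φ → Tendsto (fun i => ∑' x, φ x * F i x) l (𝓝 (∑' x, φ x * g x))) :
    g ∈ S := by
  have : Tendsto (fun i => L1.mk (F i) (hF1 i)) l (𝓝 (L1.mk g hg)) := by
    rw [(isInducing_L1 G).tendsto_nhds_iff, tendsto_pi_nhds]
    exact fun φ => h φ.1 φ.2
  exact IsClosed.mem_of_tendsto (s := {f : L1 G | f.1 ∈ S}) hS this (Eventually.of_forall hF)

theorem WStarClosed.mem_of_dominated {S : Set (G → ℂ)} (hS : WStarClosed S) {ι : Type*}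
    {l : Filter ι} [NeBot l] {F : ι → G → ℂ} {g : G → ℂ} {b : G → ℝ} (hb : Summable b)
    (hFb : ∀ i x, ‖F i x‖ ≤ b x) (hF : ∀ i, F i ∈ S)
    (h : ∀ x, Tendsto (fun i => F i x) l (𝓝 (g x))) : g ∈ S := by
  have hgb : ∀ x, ‖g x‖ ≤ b x := fun x =>
    le_of_tendsto (h x).norm (Eventually.of_forall fun i => hFb i x)
  refine hS.mem_of_tendsto (l := l) (F := F) (MemL1.of_norm_le hb hgb)
    (fun i => MemL1.of_norm_le hb (hFb i)) hF fun φ hφ => ?_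
  obtain ⟨C, hC⟩ := hφ.exists_bound
  refine tendsto_tsum_of_dominated_convergence (hb.mul_left C)
    (fun x => (h x).const_mul (φ x)) (Eventually.of_forall fun i x => ?_)
  rw [norm_mul]
  exact mul_le_mul (hC x) (hFb i x) (norm_nonneg _) ((norm_nonneg _).trans (hC x))

theorem WStarClosed.preimage {S : Set (G → ℂ)} (hS : WStarClosed S)
    {A : (G → ℂ) → G → ℂ} (hA : ∀ f, MemL1 f → MemL1 (A f))
    (hAφ : ∀ φ, MemC0 φ → ∃ ψ, MemC0 ψ ∧ ∀ f, ∑' x, φ x * A f x = ∑' x, ψ x * f x) :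
    WStarClosed {f | A f ∈ S} := by
  have : Continuous fun f : L1 G => L1.mk (A f.1) (hA _ f.2) := by
    rw [(isInducing_L1 G).continuous_iff]
    refine continuous_pi fun φ => ?_
    obtain ⟨ψ, hψ, h⟩ := hAφ φ.1 φ.2
    exact (L1.continuous_pairing hψ).congr fun f => (h f.1).symm
  exact IsClosed.preimage (t := {f : L1 G | f.1 ∈ S}) this hS

theorem memL1_delta (t : G) : MemL1 (delta t) :=
  summable_of_hasFiniteSupport <| (Set.finite_singleton t).subset fun x hx => by
    by_contra h
    exact hx (by simp_all [delta])

/-- A weak*-closed linear subspace contains the convergent superpositions of its elements. -/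
theorem WStarClosed.tsum_mem {S : Set (G → ℂ)} (hS : WStarClosed S) (h0 : 0 ∈ S)
    (hadd : ∀ f ∈ S, ∀ g ∈ S, f + g ∈ S) {ι : Type*} {u : ι → G → ℂ} (hu : ∀ i, u i ∈ S)
    {b : G → ℝ} (hb : Summable b) (hub : ∀ (F : Finset ι) x, ‖∑ i ∈ F, u i x‖ ≤ b x)
    (hs : ∀ x, Summable fun i => u i x) : (fun x => ∑' i, u i x) ∈ S := by
  refine hS.mem_of_dominated (l := atTop) (F := fun F : Finset ι => fun x => ∑ i ∈ F, u i x)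
    hb hub (fun F => ?_) fun x => (hs x).hasSum
  have : (fun x => ∑ i ∈ F, u i x) = ∑ i ∈ F, u i := by ext x; simp
  rw [this]
  exact Finset.sum_induction u (· ∈ S) (fun a b ha hb => hadd a ha b hb) h0 fun i _ => hu i

/-- Absolute convergence of a twisted convolution `Σ_s g(s) f(e_s x)`. -/
theorem summable_translates {f g : G → ℂ} (hf : MemL1 f) (hg : MemL1 g) (e : G → G ≃ G) :
    (∀ x, Summable fun s => ‖g s * f (e s x)‖) ∧ Summable fun x => ∑' s, ‖g s * f (e s x)‖ := by
  have h : Summable fun p : G × G => ‖g p.1 * f p.2‖ := by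
    simpa using Summable.mul_norm hg hf
  have h' : Summable fun p : G × G => ‖g p.1 * f (e p.1 p.2)‖ :=
    h.comp_injective (i := fun p : G × G => (p.1, e p.1 p.2)) fun p q hpq => by
      obtain ⟨h1, h2⟩ := Prod.ext_iff.1 hpq
      dsimp only at h1 h2
      rw [h1] at h2
      exact Prod.ext h1 ((e q.1).injective h2)
  have h'' : Summable fun p : G × G => ‖g p.2 * f (e p.2 p.1)‖ := h'.prod_symm
  exact ⟨fun x => h''.prod_factor x, h''.prod⟩

theorem WStarClosed.translates_mem {S : Set (G → ℂ)} (hS : WStarClosed S) (h0 : 0 ∈ S)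
    (hadd : ∀ f ∈ S, ∀ g ∈ S, f + g ∈ S) (hsmul : ∀ (c : ℂ), ∀ f ∈ S, c • f ∈ S)
    {f g : G → ℂ} (hf : MemL1 f) (hg : MemL1 g) (e : G → G ≃ G)
    (hmem : ∀ s, (fun x => f (e s x)) ∈ S) : (fun x => ∑' s, g s * f (e s x)) ∈ S := by
  obtain ⟨h1, h2⟩ := summable_translates hf hg e
  refine hS.tsum_mem h0 hadd (u := fun s x => g s * f (e s x))
    (fun s => hsmul (g s) _ (hmem s)) h2 (fun F x => ?_) fun x => (h1 x).of_norm
  exact (norm_sum_le _ _).trans ((h1 x).sum_le_tsum F fun _ _ => norm_nonneg _)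

end WeakStar

section Convolution

variable {G : Type*} [Group G]

theorem convFn_delta_left (t : G) (f : G → ℂ) : convFn (delta t) f = fun x => f (t⁻¹ * x) := by
  ext x
  simp only [convFn]
  rw [tsum_eq_single t fun y hy => by simp [delta, hy]]
  simp [delta]

theorem convFn_eq_tsum_right (f g : G → ℂ) (x : G) :
    convFn f g x = ∑' s, g s * f (x * s⁻¹) := by
  rw [convFn, ← ((Equiv.inv G).trans (Equiv.mulLeft x)).tsum_eq]
  exact tsum_congr fun s => by simp [mul_comm]

theorem convFn_delta_right (t : G) (f : G → ℂ) : convFn f (delta t) = fun x => f (x * t⁻¹) := by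
  ext x
  rw [convFn_eq_tsum_right, tsum_eq_single t fun y hy => by simp [delta, hy]]
  simp [delta]

theorem isWStarClosedIdeal_of_translates {S : Set (G → ℂ)} (hS1 : S ⊆ {f | MemL1 f})
    (h0 : 0 ∈ S) (hadd : ∀ f ∈ S, ∀ g ∈ S, f + g ∈ S)
    (hsmul : ∀ (c : ℂ), ∀ f ∈ S, c • f ∈ S) (hS : WStarClosed S)
    (hl : ∀ f ∈ S, ∀ s : G, (fun x => f (s * x)) ∈ S)
    (hr : ∀ f ∈ S, ∀ s : G, (fun x => f (x * s)) ∈ S) : IsWStarClosedIdeal S := by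
  refine ⟨hS1, h0, hadd, hsmul, fun f hf g hg => ⟨?_, ?_⟩, hS⟩
  · exact hS.translates_mem h0 hadd hsmul (hS1 hf) hg (fun s => Equiv.mulLeft s⁻¹)
      fun s => hl f hf s⁻¹
  · rw [show convFn f g = _ from funext (convFn_eq_tsum_right f g)]
    exact hS.translates_mem h0 hadd hsmul (hS1 hf) hg (fun s => Equiv.mulRight s⁻¹)
      fun s => hr f hf s⁻¹

theorem MemL1.convFn {f g : G → ℂ} (hf : MemL1 f) (hg : MemL1 g) : MemL1 (convFn f g) := by
  obtain ⟨h1, h2⟩ := summable_translates hg hf fun s => Equiv.mulLeft s⁻¹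
  exact MemL1.of_norm_le h2 fun x => norm_tsum_le_tsum_norm (h1 x)

theorem suppIn_convFn {N : Subgroup G} {f g : G → ℂ} (hf : SuppIn (N : Set G) f)
    (hg : SuppIn (N : Set G) g) : SuppIn (N : Set G) (convFn f g) := by
  intro x hx
  refine (tsum_congr fun s => ?_).trans tsum_zero
  by_cases hs : s ∈ N
  · rw [hg, mul_zero]
    exact fun h => hx (by simpa using N.mul_mem hs h)
  · rw [hf s hs, zero_mul]

theorem IsWStarClosedIdeal.translate_left {I : Set (G → ℂ)} (hI : IsWStarClosedIdeal I)
    {f : G → ℂ} (hf : f ∈ I) (s : G) : (fun x => f (s * x)) ∈ I := by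
  obtain ⟨-, -, -, -, hmul, -⟩ := hI
  simpa [convFn_delta_left] using (hmul f hf _ (memL1_delta s⁻¹)).1

theorem IsWStarClosedIdeal.translate_right {I : Set (G → ℂ)} (hI : IsWStarClosedIdeal I)
    {f : G → ℂ} (hf : f ∈ I) (s : G) : (fun x => f (x * s)) ∈ I := by
  obtain ⟨-, -, -, -, hmul, -⟩ := hI
  simpa [convFn_delta_right] using (hmul f hf _ (memL1_delta s⁻¹)).2

theorem IsWStarClosedIdeal.conjFn_mem {I : Set (G → ℂ)} (hI : IsWStarClosedIdeal I)
    {f : G → ℂ} (hf : f ∈ I) (s : G) : conjFn s f ∈ I := by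
  have h := hI.translate_right (hI.translate_left hf s⁻¹) s
  simp only [← mul_assoc] at h
  exact h

theorem gConjInvariant_of_conjFn_mem {J : Set (G → ℂ)}
    (h : ∀ s, ∀ f ∈ J, conjFn s f ∈ J) : GConjInvariant J := by
  refine fun s => Set.Subset.antisymm ?_ fun f hf => ⟨conjFn s⁻¹ f, h s⁻¹ f hf, ?_⟩
  · rintro _ ⟨f, hf, rfl⟩
    exact h s f hf
  · ext x
    simp [conjFn, mul_assoc]

/-- Restriction to the FC-centre maps a weak*-closed ideal into itself: the restriction is a
weak*-limit of conjugates. -/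
theorem IsWStarClosedIdeal.indicator_mem {I : Set (G → ℂ)} (hI : IsWStarClosedIdeal I)
    {f : G → ℂ} (hf : f ∈ I) : (FCset G).indicator f ∈ I := by
  have hf1 : MemL1 f := hI.1 hf
  have hclosed : WStarClosed I := hI.2.2.2.2.2
  choose s hs hs' using exists_conj_separating (G := G)
  have hconj : ∀ K, conjFn (s K) f ∈ I := fun K => hI.conjFn_mem hf (s K)
  refine hclosed.mem_of_tendsto (l := atTop) (F := fun K : Finset G => conjFn (s K) f)
    (hf1.indicator _) (fun K => hI.1 (hconj K)) hconj fun φ hφ => ?_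
  obtain ⟨C, hC⟩ := hφ.exists_bound
  have h1 : ∀ K, ∑' x, φ x * conjFn (s K) f x = ∑' x, φ (s K * x * (s K)⁻¹) * f x := by
    intro K
    rw [← (MulAut.conj (s K)).toEquiv.tsum_eq]
    exact tsum_congr fun x => by simp [conjFn, mul_assoc]
  have h2 : ∑' x, φ x * (FCset G).indicator f x = ∑' x, (FCset G).indicator φ x * f x :=
    tsum_congr fun x => by by_cases hx : x ∈ FCset G <;> simp [hx]
  simp only [h1, h2]
  refine tendsto_tsum_of_dominated_convergence (Summable.mul_left C hf1) (fun x => ?_)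
    (Eventually.of_forall fun K x => ?_)
  · refine Tendsto.mul_const _ ?_
    by_cases hx : x ∈ FCset G
    · refine tendsto_const_nhds.congr' ?_
      filter_upwards [eventually_ge_atTop ({x} : Finset G)] with K hK
      rw [hs K x (hK (Finset.mem_singleton_self x)) hx, Set.indicator_of_mem hx]
    · rw [Set.indicator_of_notMem hx]
      refine hφ.comp (le_cofinite_iff_eventually_ne.2 fun y => eventually_map.2 ?_)
      filter_upwards [eventually_ge_atTop ({x, y} : Finset G)] with K hK
      rintro rfl
      exact hs' K x (hK (by simp)) hx (hK (by simp))
  · rw [norm_mul]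
    exact mul_le_mul_of_nonneg_right (hC _) (norm_nonneg _)

end Convolution

section Transversal

variable {G : Type*} [Group G]

theorem mem_bigOplus {N T : Set G} {J : Set (G → ℂ)} {f : G → ℂ} :
    f ∈ bigOplus N T J ↔ MemL1 f ∧ ∀ t ∈ T, N.indicator (fun x => f (t * x)) ∈ J := by
  simp [bigOplus, convFn_delta_left]

/-- Elements of an ideal `J` of `ℓ¹(N)` are stable under translation by `N`. -/
theorem IsIdealOn.translate_left {N : Subgroup G} {J : Set (G → ℂ)}
    (hJ : IsIdealOn (N : Set G) J) {f : G → ℂ} (hf : f ∈ J) {n : G} (hn : n ∈ N) :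
    (fun x => f (n * x)) ∈ J := by
  obtain ⟨-, -, -, -, hmul⟩ := hJ
  have : delta n⁻¹ ∈ L1On (N : Set G) := by
    refine ⟨memL1_delta _, fun x hx => ?_⟩
    rw [delta, if_neg]
    rintro rfl
    exact hx (N.inv_mem hn)
  simpa [convFn_delta_left] using (hmul f hf _ this).1

theorem forall_indicator_translate_mem {N : Subgroup G} {T : Set G}
    (hT : IsTransversal (N : Set G) T) {J : Set (G → ℂ)} (hJ : IsIdealOn (N : Set G) J)
    {f : G → ℂ} (hf : ∀ t ∈ T, (N : Set G).indicator (fun x => f (t * x)) ∈ J) (g : G) :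
    (N : Set G).indicator (fun x => f (g * x)) ∈ J := by
  obtain ⟨t, ⟨ht, hn⟩, -⟩ := hT g
  convert hJ.translate_left (hf t ht) hn using 1
  ext x
  by_cases hx : x ∈ N
  · have : t⁻¹ * g * x ∈ N := N.mul_mem hn hx
    rw [Set.indicator_of_mem hx, Set.indicator_of_mem this]
    simp [mul_assoc]
  · have : t⁻¹ * g * x ∉ N := fun h => hx ((N.mul_mem_cancel_left hn).1 h)
    rw [Set.indicator_of_notMem hx, Set.indicator_of_notMem this]

theorem isWStarClosedIdeal_bigOplus {N : Subgroup G} [N.Normal] {T : Set G}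
    (hT : IsTransversal (N : Set G) T) {J : Set (G → ℂ)} (hJ : IsIdealOn (N : Set G) J)
    (hJc : WStarClosed J) (hJG : GConjInvariant J) :
    IsWStarClosedIdeal (bigOplus (N : Set G) T J) := by
  have hmem : ∀ {f : G → ℂ}, f ∈ bigOplus (N : Set G) T J ↔
      MemL1 f ∧ ∀ g, (N : Set G).indicator (fun x => f (g * x)) ∈ J := fun {f} =>
    mem_bigOplus.trans (and_congr_right fun _ =>
      ⟨fun h => forall_indicator_translate_mem hT hJ h, fun h t _ => h t⟩)
  have ⟨_, h0, hadd, hsmul, _⟩ := hJ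
  refine isWStarClosedIdeal_of_translates (fun f hf => hf.1) ?_ ?_ ?_ ?_ ?_ ?_
  · exact hmem.2 ⟨by simp [MemL1, summable_zero], fun g => by
      convert h0 using 1
      exact Set.indicator_zero _ _⟩
  · intro f hf f' hf'
    rw [hmem] at hf hf' ⊢
    refine ⟨MemL1.of_norm_le (hf.1.add hf'.1) fun x => norm_add_le _ _, fun g => ?_⟩
    convert hadd _ (hf.2 g) _ (hf'.2 g) using 1
    exact Set.indicator_add _ _ _
  · intro c f hf
    rw [hmem] at hf ⊢
    refine ⟨MemL1.of_norm_le (Summable.mul_left ‖c‖ hf.1) fun x => norm_mul_le c (f x),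
      fun g => ?_⟩
    convert hsmul c _ (hf.2 g) using 1
    exact Set.indicator_const_smul _ c _
  · have hcl : ∀ t : G,
        WStarClosed {f : G → ℂ | (N : Set G).indicator (fun x => f (t * x)) ∈ J} := by
      refine fun t => hJc.preimage
        (fun f hf => (hf.comp_injective (mul_right_injective t)).indicator _) fun φ hφ => ?_
      refine ⟨fun x => (N : Set G).indicator φ (t⁻¹ * x),
        (hφ.indicator _).comp_injective (mul_right_injective t⁻¹), fun f => ?_⟩
      rw [← (Equiv.mulLeft t).tsum_eq fun x => (N : Set G).indicator φ (t⁻¹ * x) * f x]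
      refine tsum_congr fun x => ?_
      by_cases hx : x ∈ N <;> simp [hx]
    have : {f : L1 G | f.1 ∈ bigOplus (N : Set G) T J} =
        ⋂ t : G, {f : L1 G | (N : Set G).indicator (fun x => f.1 (t * x)) ∈ J} := by
      ext f
      simp only [Set.mem_ofPred_eq, Set.mem_iInter, hmem]
      exact and_iff_right f.2
    unfold WStarClosed
    rw [this]
    exact isClosed_iInter hcl
  · intro f hf s
    rw [hmem] at hf ⊢
    refine ⟨hf.1.comp_injective (mul_right_injective s), fun g => ?_⟩
    simpa [mul_assoc] using hf.2 (s * g)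
  · intro f hf s
    rw [hmem] at hf ⊢
    refine ⟨hf.1.comp_injective (mul_left_injective s), fun g => ?_⟩
    rw [← hJG s]
    refine ⟨_, hf.2 (g * s), ?_⟩
    ext x
    have hiff : s⁻¹ * x * s ∈ N ↔ x ∈ N := by
      refine ⟨fun h => ?_, fun h => ?_⟩
      · simpa [mul_assoc] using Subgroup.Normal.conj_mem ‹N.Normal› _ h s
      · simpa using Subgroup.Normal.conj_mem ‹N.Normal› _ h s⁻¹
    by_cases hx : x ∈ N
    · rw [conjFn, Set.indicator_of_mem (hiff.2 hx), Set.indicator_of_mem hx]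
      simp [mul_assoc]
    · rw [conjFn, Set.indicator_of_notMem (mt hiff.1 hx), Set.indicator_of_notMem hx]

theorem IsWStarClosedIdeal.isIdealOn_inter {I : Set (G → ℂ)} (hI : IsWStarClosedIdeal I)
    (N : Subgroup G) : IsIdealOn (N : Set G) (I ∩ L1On (N : Set G)) := by
  obtain ⟨hI1, h0, hadd, hsmul, hmul, -⟩ := hI
  refine ⟨Set.inter_subset_right, ⟨h0, hI1 h0, fun _ _ => rfl⟩, ?_, ?_, ?_⟩
  · intro f hf g hg
    have h := hadd f hf.1 g hg.1
    exact ⟨h, hI1 h, fun x hx => by simp [hf.2.2 x hx, hg.2.2 x hx]⟩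
  · intro c f hf
    have h := hsmul c f hf.1
    exact ⟨h, hI1 h, fun x hx => by simp [hf.2.2 x hx]⟩
  · intro f hf g hg
    obtain ⟨h, h'⟩ := hmul f hf.1 g hg.1
    exact ⟨⟨h, hI1 h, suppIn_convFn hg.2 hf.2.2⟩, ⟨h', hI1 h', suppIn_convFn hf.2.2 hg.2⟩⟩

theorem IsWStarClosedIdeal.gConjInvariant_inter {I : Set (G → ℂ)} (hI : IsWStarClosedIdeal I)
    (N : Subgroup G) [N.Normal] : GConjInvariant (I ∩ L1On (N : Set G)) := by
  refine gConjInvariant_of_conjFn_mem fun s f hf => ?_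
  have h : conjFn s f ∈ I := hI.conjFn_mem hf.1 s
  refine ⟨h, hI.1 h, fun x hx => hf.2.2 _ fun hx' => hx ?_⟩
  simpa [mul_assoc] using Subgroup.Normal.conj_mem ‹N.Normal› _ hx' s

/-- A weak*-closed ideal contains every function whose translated restrictions it contains. -/
theorem IsWStarClosedIdeal.mem_of_indicator_mem {I : Set (G → ℂ)} (hI : IsWStarClosedIdeal I)
    {N T : Set G} (hT : IsTransversal N T) {f : G → ℂ} (hf : MemL1 f)
    (h : ∀ t ∈ T, N.indicator (fun x => f (t * x)) ∈ I) : f ∈ I := by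
  have hcl : WStarClosed I := hI.2.2.2.2.2
  set u : T → G → ℂ := fun t x => N.indicator (fun y => f (t * y)) ((t : G)⁻¹ * x) with hu_def
  have hu : ∀ (t : T) x, u t x = if (t : G)⁻¹ * x ∈ N then f x else 0 := fun t x => by
    simp [hu_def, Set.indicator_apply]
  have hsingle : ∀ x, ∃ t₀ : T, u t₀ x = f x ∧ ∀ t, t ≠ t₀ → u t x = 0 := by
    intro x
    obtain ⟨t, ⟨ht, hn⟩, huniq⟩ := hT x
    refine ⟨⟨t, ht⟩, by simp [hu, hn], fun t' ht' => ?_⟩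
    rw [hu, if_neg]
    exact fun h => ht' (Subtype.ext (huniq t' ⟨t'.2, h⟩))
  have hf_eq : f = fun x => ∑' t, u t x := by
    ext x
    obtain ⟨t₀, h0, h1⟩ := hsingle x
    rw [tsum_eq_single t₀ h1, h0]
  rw [hf_eq]
  refine hcl.tsum_mem hI.2.1 hI.2.2.1 (fun t => hI.translate_left (h t t.2) _) hf
    (fun F x => ?_) fun x => ?_
  · obtain ⟨t₀, h0, h1⟩ := hsingle x
    by_cases hF : t₀ ∈ F
    · rw [Finset.sum_eq_single_of_mem t₀ hF fun t _ ht => h1 t ht, h0]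
    · rw [Finset.sum_eq_zero fun t ht => h1 t fun e => hF (e ▸ ht), norm_zero]
      exact norm_nonneg _
  · obtain ⟨t₀, -, h1⟩ := hsingle x
    exact (hasSum_single t₀ h1).summable

end Transversal

/-- **Theorem 2.** Let `T` be a transversal for `FC(G)` in `G`. The weak*-closed
two-sided ideals of `ℓ¹(G)` are exactly the sets `⊕_{t∈T} δ_t * J`, where `J` is a
weak*-closed two-sided ideal of `ℓ¹(FC(G))` invariant under conjugation by `G`. -/
theorem weakStarClosed_ideals_of_ell1 (G : Type*) [Group G] (T : Set G)
    (hT : IsTransversal (FCset G) T) (I : Set (G → ℂ)) :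
    IsWStarClosedIdeal I ↔
      ∃ J : Set (G → ℂ), IsIdealOn (FCset G) J ∧ WStarClosed J ∧ GConjInvariant J ∧
        I = bigOplus (FCset G) T J := by
  constructor
  · intro hI
    refine ⟨I ∩ L1On (FCset G), hI.isIdealOn_inter (fcSubgroup G),
      WStarClosed.inter hI.2.2.2.2.2 (wStarClosed_L1On _),
      hI.gConjInvariant_inter (fcSubgroup G), ?_⟩
    ext f
    rw [mem_bigOplus]
    refine ⟨fun hf => ⟨hI.1 hf, fun t _ => ?_⟩, fun hf =>
      hI.mem_of_indicator_mem hT hf.1 fun t ht => (hf.2 t ht).1⟩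
    have h := hI.indicator_mem (hI.translate_left hf t)
    exact ⟨h, hI.1 h, fun x hx => Set.indicator_of_notMem hx _⟩
  · rintro ⟨J, hJ, hJc, hJG, rfl⟩
    exact isWStarClosedIdeal_bigOplus (N := fcSubgroup G) hT hJ hJc hJG
end
end

section
/- Let G be a discrete group and 1 ≤ p < ∞. Then the centre of CV_p(G) is Z(CV_p(G)) = {T ∈ CV_p(G) : Tδ_e is constant on each conjugacy class of G}. In particular, CV_p(G) has trivial centre (equal to the scalar multiples of the identity operator) if and only if G is an ICC group. -/
noncomputable section

open Filter Topology
open scoped ENNReal Classical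

/-- `ℓ^p(G)`. -/
abbrev lpSpace (G : Type*) (p : ℝ≥0∞) := lp (fun _ : G => ℂ) p

theorem Memℓp.comp_equiv {α : Type*} {p : ℝ≥0∞} {f : α → ℂ} (hf : Memℓp f p) (e : α ≃ α) :
    Memℓp (fun x => f (e x)) p := by
  rcases p.trichotomy with rfl | rfl | hp
  · rw [memℓp_zero_iff] at hf ⊢
    have h : {x | f (e x) ≠ 0} = e ⁻¹' {i | f i ≠ 0} := rfl
    rw [h]
    exact hf.preimage e.injective.injOn
  · rw [memℓp_infty_iff] at hf ⊢
    have h : (Set.range fun x => ‖f (e x)‖) = Set.range fun i => ‖f i‖ := by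
      ext r
      constructor
      · rintro ⟨x, rfl⟩; exact ⟨e x, rfl⟩
      · rintro ⟨i, rfl⟩; exact ⟨e.symm i, by simp⟩
    rwa [h]
  · rw [memℓp_gen_iff hp] at hf ⊢
    exact (Equiv.summable_iff e).mpr hf

/-- The right regular representation: `ρ_p(t) ξ = ξ * δ_t`, i.e. `(ρ_p(t)ξ)(x) = ξ(x t⁻¹)`. -/
def rtransl {G : Type*} [Group G] {p : ℝ≥0∞} (t : G) (ξ : lpSpace G p) : lpSpace G p :=
  ⟨fun x => ξ (x * t⁻¹), (lp.memℓp ξ).comp_equiv (Equiv.mulRight t⁻¹)⟩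

/-- The algebra `CV_p(G)` of `p`-convolution operators on the discrete group `G`:
bounded operators on `ℓ^p(G)` commuting with right translations. -/
def CVp (G : Type*) [Group G] (p : ℝ≥0∞) [Fact (1 ≤ p)] :
    Set (lpSpace G p →L[ℂ] lpSpace G p) :=
  {T | ∀ (t : G) (ξ : lpSpace G p), T (rtransl t ξ) = rtransl t (T ξ)}

/-- `G` is an ICC group: every conjugacy class other than `{1}` is infinite. -/
def ICC (G : Type*) [Group G] : Prop := ∀ g : G, g ≠ 1 → {x : G | IsConj g x}.Infinite

section ConvolutionOperators

theorem eq_zero_of_const_on_infinite {α : Type*} {p : ℝ≥0∞} [Fact (1 ≤ p)] (hp : p ≠ ∞)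
    (f : lpSpace α p) {s : Set α} (hs : s.Infinite) {c : ℂ} (hc : ∀ x ∈ s, f x = c) : c = 0 := by
  have hp₀ : 0 < p.toReal := ENNReal.toReal_pos (zero_lt_one.trans_le Fact.out).ne' hp
  have : Infinite s := hs.to_subtype
  have h := ((memℓp_gen_iff hp₀).1 (lp.memℓp f)).subtype s
  have hconst : Summable fun _ : s => ‖c‖ ^ p.toReal :=
    h.congr fun x => by simp [hc x.1 x.2]
  rw [summable_const_iff, Real.rpow_eq_zero (norm_nonneg c) hp₀.ne', norm_eq_zero] at hconst
  exact hconst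

variable {G : Type*} [Group G] {p : ℝ≥0∞}

theorem rtransl_single_one (t : G) :
    rtransl t (lp.single p (1 : G) (1 : ℂ) : lpSpace G p) = lp.single p t 1 := by
  ext x
  change (Pi.single (1 : G) (1 : ℂ) : G → ℂ) (x * t⁻¹) = (Pi.single t (1 : ℂ) : G → ℂ) x
  simp [Pi.single_apply, mul_inv_eq_one]

variable [Fact (1 ≤ p)]

/-- The left regular representation: `(λ_p(t)ξ)(x) = ξ(t⁻¹ x)`. -/
def ltransl (hp : p ≠ ∞) (t : G) : lpSpace G p →L[ℂ] lpSpace G p :=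
  LinearMap.mkContinuous
    { toFun := fun ξ => ⟨fun x => ξ (t⁻¹ * x), (lp.memℓp ξ).comp_equiv (Equiv.mulLeft t⁻¹)⟩
      map_add' := fun _ _ => rfl
      map_smul' := fun _ _ => rfl } 1 fun ξ => by
    have hp₀ : 0 < p.toReal := ENNReal.toReal_pos (zero_lt_one.trans_le Fact.out).ne' hp
    rw [one_mul, lp.norm_eq_tsum_rpow hp₀, lp.norm_eq_tsum_rpow hp₀ ξ]
    exact (congrArg (· ^ (1 / p.toReal))
      ((Equiv.mulLeft t⁻¹).tsum_eq fun x => ‖ξ x‖ ^ p.toReal)).le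

@[simp]
theorem ltransl_apply (hp : p ≠ ∞) (t : G) (ξ : lpSpace G p) (x : G) :
    ltransl hp t ξ x = ξ (t⁻¹ * x) := rfl

theorem ltransl_mem_CVp (hp : p ≠ ∞) (t : G) : ltransl hp t ∈ CVp G p := by
  intro s ξ
  ext x
  change ξ (t⁻¹ * x * s⁻¹) = ξ (t⁻¹ * (x * s⁻¹))
  rw [mul_assoc]

theorem ltransl_single_one (hp : p ≠ ∞) (t : G) :
    ltransl hp t (lp.single p (1 : G) (1 : ℂ)) = lp.single p t 1 := by
  ext x
  rw [ltransl_apply]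
  simp [Pi.single_apply, inv_mul_eq_one, eq_comm]

theorem comp_mem_CVp {S T : lpSpace G p →L[ℂ] lpSpace G p} (hS : S ∈ CVp G p)
    (hT : T ∈ CVp G p) : S.comp T ∈ CVp G p := by
  intro t ξ
  simp [hT t ξ, hS t (T ξ)]

theorem smul_id_mem_CVp (a : ℂ) :
    a • ContinuousLinearMap.id ℂ (lpSpace G p) ∈ CVp G p :=
  fun _ _ => rfl

theorem sum_mem_CVp {ι : Type*} (s : Finset ι) {T : ι → lpSpace G p →L[ℂ] lpSpace G p}
    (hT : ∀ i ∈ s, T i ∈ CVp G p) : ∑ i ∈ s, T i ∈ CVp G p := by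
  intro t ξ
  ext x
  change (∑ i ∈ s, T i) (rtransl t ξ) x = (∑ i ∈ s, T i) ξ (x * t⁻¹)
  simp only [sum_apply, lp.coeFn_sum, Finset.sum_apply]
  exact Finset.sum_congr rfl fun i hi => by rw [hT i hi]; rfl

/-- A `p`-convolution operator acts as convolution by its value at `δ_e`. -/
theorem hasSum_apply_of_mem_CVp (hp : p ≠ ∞) {S : lpSpace G p →L[ℂ] lpSpace G p}
    (hS : S ∈ CVp G p) (ξ : lpSpace G p) (x : G) :
    HasSum (fun y => ξ y * S (lp.single p (1 : G) 1) (x * y⁻¹)) (S ξ x) := by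
  have h := ((lp.evalCLM ℂ (fun _ : G => ℂ) p x).comp S).hasSum (lp.hasSum_single hp ξ)
  refine h.congr_fun ?_
  intro y
  have hy : lp.single p y (ξ y) = ξ y • rtransl y (lp.single p (1 : G) (1 : ℂ)) := by
    rw [rtransl_single_one, ← lp.single_smul, smul_eq_mul, mul_one]
  change _ = S (lp.single p y (ξ y)) x
  rw [hy, map_smul, hS]
  rfl

theorem eq_of_apply_single_one (hp : p ≠ ∞) {S T : lpSpace G p →L[ℂ] lpSpace G p}
    (hS : S ∈ CVp G p) (hT : T ∈ CVp G p)
    (h : S (lp.single p (1 : G) 1) = T (lp.single p (1 : G) 1)) : S = T := by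
  ext ξ x
  have hSx := hasSum_apply_of_mem_CVp hp hS ξ x
  rw [h] at hSx
  exact hSx.unique (hasSum_apply_of_mem_CVp hp hT ξ x)

theorem centre_CVp_eq (hp : p ≠ ∞) :
    {T | T ∈ CVp G p ∧ ∀ S ∈ CVp G p, S.comp T = T.comp S} =
      {T | T ∈ CVp G p ∧ ∀ x y : G, IsConj x y →
        T (lp.single p (1 : G) 1) x = T (lp.single p (1 : G) 1) y} := by
  ext T
  refine and_congr_right fun hT => ⟨fun h x y hxy => ?_, fun h S hS => ?_⟩
  · obtain ⟨c, rfl⟩ := isConj_iff.1 hxy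
    have hc := congrArg (fun A => A (lp.single p (1 : G) 1) (c * x))
      (h _ (ltransl_mem_CVp hp c))
    simp only [ContinuousLinearMap.comp_apply, ltransl_single_one, ltransl_apply,
      inv_mul_cancel_left] at hc
    rw [← rtransl_single_one c, hT] at hc
    exact hc
  · refine eq_of_apply_single_one hp (comp_mem_CVp hS hT) (comp_mem_CVp hT hS) ?_
    ext x
    have hST := hasSum_apply_of_mem_CVp hp hS (T (lp.single p (1 : G) 1)) x
    have hTS := hasSum_apply_of_mem_CVp hp hT (S (lp.single p (1 : G) 1)) x
    refine hST.unique ?_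
    rw [← ((Equiv.inv G).trans (Equiv.mulRight x)).hasSum_iff]
    refine hTS.congr_fun fun z => ?_
    have hz : IsConj (z⁻¹ * x) (x * z⁻¹) := isConj_iff.2 ⟨z, by group⟩
    simp [h _ _ hz, mul_comm]

theorem smul_id_mem_centre (a : ℂ) :
    a • ContinuousLinearMap.id ℂ (lpSpace G p) ∈
      {T | T ∈ CVp G p ∧ ∀ S ∈ CVp G p, S.comp T = T.comp S} :=
  ⟨smul_id_mem_CVp a, fun S _ => by ext; simp⟩

theorem icc_of_forall_class_function_scalar (hp : p ≠ ∞)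
    (h : ∀ T ∈ CVp G p, (∀ x y : G, IsConj x y →
      T (lp.single p (1 : G) 1) x = T (lp.single p (1 : G) 1) y) →
      ∃ a : ℂ, T = a • ContinuousLinearMap.id ℂ (lpSpace G p)) : ICC G := by
  intro g hg hfin
  change Set.Finite _ at hfin
  have hval (x : G) : (∑ c ∈ hfin.toFinset, ltransl hp c) (lp.single p (1 : G) (1 : ℂ)) x =
      if IsConj g x then 1 else 0 := by
    simp only [sum_apply, ltransl_single_one, lp.coeFn_sum, Finset.sum_apply, lp.coeFn_single,
      Finset.sum_pi_single, Set.Finite.mem_toFinset, Set.mem_ofPred_eq]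
  obtain ⟨a, ha⟩ := h (∑ c ∈ hfin.toFinset, ltransl hp c)
    (sum_mem_CVp _ fun c _ => ltransl_mem_CVp hp c) fun x y hxy => by
      rw [hval, hval]
      have : IsConj g x ↔ IsConj g y := ⟨fun h => h.trans hxy, fun h => h.trans hxy.symm⟩
      simp only [this]
  have hgval := hval g
  rw [ha, if_pos (IsConj.refl g)] at hgval
  simp [hg] at hgval

end ConvolutionOperators

/-- **Lemma 2.2.** For `1 ≤ p < ∞`, the centre of `CV_p(G)` consists exactly of those
`T ∈ CV_p(G)` such that `Tδ_e` is constant on conjugacy classes; in particular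
`CV_p(G)` has trivial centre (the scalar multiples of the identity) if and only if `G`
is an ICC group. -/
theorem centre_CVp (G : Type*) [Group G] (p : ℝ≥0∞) [Fact (1 ≤ p)] (hp : p ≠ ∞) :
    {T | T ∈ CVp G p ∧ ∀ S ∈ CVp G p, S.comp T = T.comp S} =
      {T | T ∈ CVp G p ∧ ∀ x y : G, IsConj x y →
        T (lp.single p (1 : G) 1) x = T (lp.single p (1 : G) 1) y} ∧
    ({T | T ∈ CVp G p ∧ ∀ S ∈ CVp G p, S.comp T = T.comp S} =
      {T : lpSpace G p →L[ℂ] lpSpace G p | ∃ a : ℂ, T = a • ContinuousLinearMap.id ℂ (lpSpace G p)}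
      ↔ ICC G) := by
  refine ⟨centre_CVp_eq hp, fun h => ?_, fun hG => ?_⟩
  · refine icc_of_forall_class_function_scalar hp fun T hT hconj => ?_
    have hmem := (centre_CVp_eq hp).superset ⟨hT, hconj⟩
    rwa [h] at hmem
  · refine Set.Subset.antisymm (fun T hT => ?_) ?_
    · rw [centre_CVp_eq hp] at hT
      obtain ⟨hT, hconj⟩ := hT
      refine ⟨T (lp.single p (1 : G) 1) 1,
        eq_of_apply_single_one hp hT (smul_id_mem_CVp _) ?_⟩
      ext x
      by_cases hx : x = 1
      · subst hx
        simp
      · rw [eq_zero_of_const_on_infinite hp _ (hG x hx) fun y hy => (hconj x y hy).symm]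
        simp [hx]
    · rintro _ ⟨a, rfl⟩
      exact smul_id_mem_centre a
end
end

section
/- Let G be a group and let H be a subgroup of G. Suppose that for some m, n ∈ ℕ there exist t₁, …, t_n ∈ G and g₁, …, g_m ∈ G such that G = ⋃_{i=1}^n ⋃_{j=1}^m t_i (g_j H g_j⁻¹). Then H has finite index in G. -/
open scoped Pointwise in
/-- **Lemma 4.3.** If `G` is covered by finitely many left cosets
`t_i (g_j H g_j⁻¹)` of finitely many conjugates of a subgroup `H`, then `H` has
finite index in `G`. -/
theorem finiteIndex_of_finite_cover_by_cosets_of_conjugates (G : Type*) [Group G]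
    (H : Subgroup G) (m n : ℕ) (t : Fin n → G) (g : Fin m → G)
    (hcover : ∀ x : G, ∃ i : Fin n, ∃ j : Fin m, ∃ h ∈ H, x = t i * (g j * h * (g j)⁻¹)) :
    H.FiniteIndex := by
  let K (p : Fin n × Fin m) : Subgroup G := H.map (MulAut.conj (g p.2) : G →* G)
  have hK : ⋃ p ∈ (Finset.univ : Finset (Fin n × Fin m)),
      t p.1 • (K p : Set G) = Set.univ := by
    refine Set.eq_univ_of_forall fun x => ?_
    obtain ⟨i, j, h, hh, rfl⟩ := hcover x
    exact Set.mem_iUnion₂.2 ⟨(i, j), Finset.mem_univ _,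
      Set.smul_mem_smul_set (Subgroup.mem_map_of_mem _ hh)⟩
  obtain ⟨p, -, hp⟩ := Subgroup.exists_finiteIndex_of_leftCoset_cover hK
  exact ⟨Subgroup.index_map_equiv H (MulAut.conj (g p.2)) ▸ hp.index_ne_zero⟩
end

section
/- Let G be a group possessing an infinite conjugacy class Y, and let W be a finite subset of FC(G). Then for every pair of finite subsets E, F ⊆ Y there exists g ∈ C_G(W) such that gEg⁻¹ ∩ F = ∅. -/
open scoped Pointwise

namespace MulAction

variable {G X : Type*} [Group G] [MulAction G X]

theorem finiteIndex_stabilizer_iff_finite_orbit {x : X} :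
    (stabilizer G x).FiniteIndex ↔ (orbit G x).Finite := by
  rw [Subgroup.finiteIndex_iff, index_stabilizer]
  exact ⟨Set.finite_of_ncard_ne_zero,
    fun h ↦ (Set.ncard_pos h).2 (nonempty_orbit x) |>.ne'⟩

/-- **Neumann's separation lemma**: finitely many points with infinite orbits can be moved
away from any finite set. -/
theorem exists_disjoint_smul_of_infinite_orbit {E F : Set X} (hE : E.Finite) (hF : F.Finite)
    (horbit : ∀ e ∈ E, (orbit G e).Infinite) : ∃ g : G, Disjoint (g • E) F := by
  classical
  by_contra! hmeet
  let transporter (p : X × X) : G := if h : ∃ g : G, g • p.1 = p.2 then h.choose else 1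
  have hcover : ⋃ p ∈ (hE.prod hF).toFinset,
      transporter p • (stabilizer G p.1 : Set G) = Set.univ := by
    refine Set.iUnion₂_eq_univ_iff.2 fun g ↦ ?_
    obtain ⟨_, ⟨e, he, rfl⟩, hf⟩ := Set.not_disjoint_iff.1 (hmeet g)
    have h : ∃ k : G, k • e = g • e := ⟨g, rfl⟩
    have htransporter : transporter (e, g • e) • e = g • e := by
      simpa only [transporter, dif_pos h] using h.choose_spec
    refine ⟨(e, g • e), (hE.prod hF).mem_toFinset.2 ⟨he, hf⟩, ?_⟩
    rw [Set.mem_smul_set_iff_inv_smul_mem, SetLike.mem_coe, mem_stabilizer_iff, smul_eq_mul,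
      mul_smul, inv_smul_eq_iff, htransporter]
  obtain ⟨p, hp, hindex⟩ := Subgroup.exists_finiteIndex_of_leftCoset_cover hcover
  exact horbit p.1 ((hE.prod hF).mem_toFinset.1 hp).1
    (finiteIndex_stabilizer_iff_finite_orbit.1 hindex)

/-- The element in Neumann's separation lemma can be found in any subgroup of finite index. -/
theorem exists_mem_disjoint_smul_of_infinite_orbit (H : Subgroup G) [H.FiniteIndex]
    {E F : Set X} (hE : E.Finite) (hF : F.Finite)
    (horbit : ∀ e ∈ E, (orbit G e).Infinite) : ∃ g ∈ H, Disjoint (g • E) F := by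
  obtain ⟨g, hg⟩ := exists_disjoint_smul_of_infinite_orbit hE
    (Set.finite_iUnion fun q : G ⧸ H ↦ hF.smul_set (a := q.out)) horbit
  obtain ⟨k, hk⟩ := QuotientGroup.mk_out_eq_mul H g
  refine ⟨(k : G)⁻¹, H.inv_mem k.2, Set.disjoint_left.2 ?_⟩
  rintro _ ⟨e, he, rfl⟩ hf
  refine Set.disjoint_left.1 hg (Set.smul_mem_smul_set he)
    (Set.mem_iUnion.2 ⟨(g : G ⧸ H), (k : G)⁻¹ • e, hf, ?_⟩)
  simp only [hk, mul_smul, smul_inv_smul]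

end MulAction

/-- **Proposition 4.4.** Let `G` be a group with an infinite conjugacy class `Y`
(the class of `y`), and let `W` be a finite subset of the FC-centre `FC(G)`. Then for
every pair of finite subsets `E, F ⊆ Y` there exists `g ∈ C_G(W)` such that
`gEg⁻¹ ∩ F = ∅`. -/
theorem exists_centralizer_elt_conj_disjoint (G : Type*) [Group G] (y : G)
    (hY : {x : G | IsConj y x}.Infinite)
    (W : Set G) (hWfin : W.Finite) (hWFC : ∀ w ∈ W, {x : G | IsConj w x}.Finite)
    (E F : Set G) (hE : E.Finite) (hF : F.Finite)
    (hEY : E ⊆ {x : G | IsConj y x}) (hFY : F ⊆ {x : G | IsConj y x}) :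
    ∃ g : G, (∀ w ∈ W, g * w = w * g) ∧ ((fun e => g * e * g⁻¹) '' E) ∩ F = ∅ := by
  have hclass (x : G) : {z : G | IsConj x z} = MulAction.orbit (ConjAct G) x := by
    ext z
    exact isConj_comm.trans ConjAct.mem_orbit_conjAct.symm
  let H : Subgroup (ConjAct G) := ⨅ w ∈ hWfin.toFinset, MulAction.stabilizer (ConjAct G) w
  have : H.FiniteIndex := Subgroup.finiteIndex_iInf' _ fun w hw ↦
    MulAction.finiteIndex_stabilizer_iff_finite_orbit.2
      (hclass w ▸ hWFC w (hWfin.mem_toFinset.1 hw))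
  obtain ⟨g, hg, hdisj⟩ := MulAction.exists_mem_disjoint_smul_of_infinite_orbit H hE hF
    fun e he ↦ by
      have hye : e ∈ MulAction.orbit (ConjAct G) y := hclass y ▸ hEY he
      rw [MulAction.orbit_eq_iff.2 hye, ← hclass]
      exact hY
  refine ⟨ConjAct.ofConjAct g, fun w hw ↦ ?_, Set.disjoint_iff_inter_eq_empty.1 hdisj⟩
  have hgw : g • w = w := by
    simp only [H, Subgroup.mem_iInf, MulAction.mem_stabilizer_iff] at hg
    exact hg w (hWfin.mem_toFinset.2 hw)
  rwa [ConjAct.smul_def, mul_inv_eq_iff_eq_mul] at hgw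
end

section
/- An infinite group G is an ICC group if and only if it is uniformly ICC, that is: for every conjugacy class Y ≠ {e} of G and every pair of finite subsets E, F ⊆ Y there exists g ∈ G such that gEg⁻¹ ∩ F = ∅. -/
open scoped Pointwise in
/-- Neumann's separation lemma: if every point of the finite set `E` has infinite orbit, some
translate of `E` is disjoint from the finite set `F`. -/
theorem MulAction.exists_smul_notMem_of_infinite_orbit {G α : Type*} [Group G] [MulAction G α]
    {E F : Set α} (hE : E.Finite) (hF : F.Finite) (h : ∀ e ∈ E, (MulAction.orbit G e).Infinite) :
    ∃ g : G, ∀ e ∈ E, g • e ∉ F := by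
  classical
  by_contra! hcon
  have hc (p : α × α) : ∃ c : G, ∀ g : G, g • p.1 = p.2 → c • p.1 = p.2 := by
    by_cases hp : ∃ c : G, c • p.1 = p.2
    · exact hp.imp fun c hc _ _ => hc
    · exact ⟨1, fun g hg => (hp ⟨g, hg⟩).elim⟩
  choose c hc using hc
  have hcovers : ⋃ p ∈ (hE.prod hF).toFinset,
      c p • (MulAction.stabilizer G p.1 : Set G) = Set.univ := by
    refine Set.iUnion₂_eq_univ_iff.mpr fun g => ?_
    obtain ⟨e, he, hf⟩ := hcon g
    refine ⟨(e, g • e), by simpa using ⟨he, hf⟩, ?_⟩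
    rw [mem_leftCoset_iff, SetLike.mem_coe, MulAction.mem_stabilizer_iff, mul_smul,
      inv_smul_eq_iff]
    exact (hc (e, g • e) g rfl).symm
  obtain ⟨p, hp, hfin⟩ := Subgroup.exists_finiteIndex_of_leftCoset_cover hcovers
  have hpE : p.1 ∈ E := ((hE.prod hF).mem_toFinset.mp hp).1
  have : Finite (G ⧸ MulAction.stabilizer G p.1) := Subgroup.finite_quotient_of_finiteIndex
  exact h p.1 hpE
    (Finite.of_equiv _ (MulAction.orbitEquivQuotientStabilizer G p.1).symm)

/-- **(Definition 4.1 / Proposition 4.4.)** An infinite group `G` is ICC if and only if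
it is uniformly ICC: for every conjugacy class `Y ≠ {1}` (the class of an element
`y ≠ 1`) and every pair of finite subsets `E, F ⊆ Y` there exists `g ∈ G` with
`gEg⁻¹ ∩ F = ∅`. -/
theorem icc_iff_uniformly_icc (G : Type*) [Group G] [Infinite G] :
    ICC G ↔
      ∀ y : G, y ≠ 1 → ∀ E F : Set G, E.Finite → F.Finite →
        E ⊆ {x : G | IsConj y x} → F ⊆ {x : G | IsConj y x} →
        ∃ g : G, ((fun e => g * e * g⁻¹) '' E) ∩ F = ∅ := by
  constructor
  · intro h y hy E F hE hF hEy _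
    have horbit : ∀ e ∈ E, (MulAction.orbit (ConjAct G) e).Infinite := by
      intro e he
      have heq : MulAction.orbit (ConjAct G) e = {x : G | IsConj y x} := by
        ext x
        rw [ConjAct.mem_orbit_conjAct]
        exact ⟨fun hx => (hEy he).trans hx.symm, fun hx => hx.symm.trans (hEy he)⟩
      exact heq ▸ h y hy
    obtain ⟨g, hg⟩ := MulAction.exists_smul_notMem_of_infinite_orbit hE hF horbit
    refine ⟨ConjAct.ofConjAct g, Set.eq_empty_iff_forall_notMem.mpr ?_⟩
    rintro _ ⟨⟨e, he, rfl⟩, hf⟩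
    exact hg e he (by rwa [ConjAct.smul_def])
  · intro h y hy hfin
    obtain ⟨g, hg⟩ := h y hy _ _ hfin hfin subset_rfl subset_rfl
    exact Set.eq_empty_iff_forall_notMem.mp hg (g * y * g⁻¹)
      ⟨⟨y, IsConj.refl y, rfl⟩, isConj_iff.mpr ⟨g, rfl⟩⟩
end

section
/- Let G be a discrete group and let I be a weak*-closed two-sided ideal of ℓ¹(G). Then for every f ∈ I, the function f·1_{FC(G)} (equal to f on FC(G) and 0 elsewhere) also belongs to I. -/
noncomputable section

open Filter Topology
open scoped Classical ENNReal

open scoped Pointwise in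
/-- A form of B. H. Neumann's lemma: finitely many points with infinite orbits can be moved
simultaneously off a given finite set. -/
theorem exists_smul_notMem_of_infinite_orbits {Γ X : Type*} [Group Γ] [MulAction Γ X]
    (E F : Finset X) (hE : ∀ x ∈ E, (MulAction.orbit Γ x).Infinite) :
    ∃ γ : Γ, ∀ x ∈ E, γ • x ∉ F := by
  by_contra! h
  let g : X × X → Γ := fun p => if h : ∃ γ : Γ, γ • p.1 = p.2 then h.choose else 1
  have hcover : ⋃ p ∈ E ×ˢ F, g p • (MulAction.stabilizer Γ p.1 : Set Γ) = Set.univ := by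
    refine Set.eq_univ_of_forall fun γ => ?_
    obtain ⟨x, hx, hy⟩ := h γ
    have hex : ∃ δ : Γ, δ • x = γ • x := ⟨γ, rfl⟩
    have hg : g (x, γ • x) • x = γ • x := by
      simp only [g, dif_pos hex]
      exact hex.choose_spec
    refine Set.mem_biUnion (x := (x, γ • x)) (by simp [hx, hy]) ?_
    rw [Set.mem_smul_set_iff_inv_smul_mem, SetLike.mem_coe, MulAction.mem_stabilizer_iff,
      smul_eq_mul, mul_smul, inv_smul_eq_iff]
    exact hg.symm
  obtain ⟨p, hp, hfin⟩ := Subgroup.exists_finiteIndex_of_leftCoset_cover hcover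
  refine hfin.index_ne_zero ?_
  rw [MulAction.index_stabilizer]
  exact (hE p.1 (Finset.mem_product.mp hp).1).ncard

/-- Orbits that are infinite remain infinite for a subgroup of finite index. -/
theorem infinite_orbit_of_finiteIndex {Γ X : Type*} [Group Γ] [MulAction Γ X]
    (H : Subgroup Γ) [H.FiniteIndex] {x : X} (hx : (MulAction.orbit Γ x).Infinite) :
    (MulAction.orbit H x).Infinite := by
  intro hfin
  have hne : (MulAction.stabilizer H x).index ≠ 0 := by
    rw [MulAction.index_stabilizer]
    exact ((MulAction.nonempty_orbit x).ncard_pos hfin).ne'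
  have hrel : (MulAction.stabilizer Γ x).relIndex H = (MulAction.stabilizer H x).index := rfl
  refine hne (hrel ▸ ?_)
  by_contra hne'
  have hidx : (MulAction.stabilizer Γ x ⊓ H).index ≠ 0 := by
    rw [← Subgroup.relIndex_mul_index (inf_le_right : MulAction.stabilizer Γ x ⊓ H ≤ H),
      Subgroup.inf_relIndex_right]
    exact mul_ne_zero hne' Subgroup.FiniteIndex.index_ne_zero
  refine hidx (Nat.eq_zero_of_zero_dvd ?_)
  rw [← hx.ncard, ← MulAction.index_stabilizer Γ x]
  exact Subgroup.index_dvd_of_le inf_le_left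

/-- Some group element fixes the points of a finite set `K` with finite orbit and moves its
points with infinite orbit off `K`. -/
theorem exists_smul_eq_and_smul_notMem {Γ X : Type*} [Group Γ] [MulAction Γ X] (K : Finset X) :
    ∃ γ : Γ, ∀ x ∈ K, ((MulAction.orbit Γ x).Finite → γ • x = x) ∧
      ((MulAction.orbit Γ x).Infinite → γ • x ∉ K) := by
  let H : Subgroup Γ :=
    ⨅ x ∈ K.filter fun x => (MulAction.orbit Γ x).Finite, MulAction.stabilizer Γ x
  have : H.FiniteIndex := by
    refine Subgroup.finiteIndex_iInf' _ fun x hx => ⟨?_⟩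
    rw [MulAction.index_stabilizer]
    exact ((MulAction.nonempty_orbit x).ncard_pos (Finset.mem_filter.mp hx).2).ne'
  obtain ⟨γ, hγ⟩ := exists_smul_notMem_of_infinite_orbits (Γ := H)
    (K.filter fun x => (MulAction.orbit Γ x).Infinite) K fun x hx =>
      infinite_orbit_of_finiteIndex H (Finset.mem_filter.mp hx).2
  refine ⟨γ, fun x hx => ⟨fun hfin => ?_, fun hinf => hγ x (Finset.mem_filter.mpr ⟨hx, hinf⟩)⟩⟩
  have hmem := γ.2
  simp only [H, Subgroup.mem_iInf] at hmem
  exact hmem x (Finset.mem_filter.mpr ⟨hx, hfin⟩)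

theorem mem_FCset_iff_finite_orbit {G : Type*} [Group G] {t : G} :
    t ∈ FCset G ↔ (MulAction.orbit (ConjAct G) t).Finite := by
  have : MulAction.orbit (ConjAct G) t = {x | IsConj t x} := by
    ext x
    rw [ConjAct.mem_orbit_conjAct, isConj_comm]
    rfl
  rw [this]
  rfl

theorem memL1_single {G : Type*} (g : G) : MemL1 (Pi.single g 1 : G → ℂ) := by
  refine summable_of_ne_finset_zero (s := {g}) fun t ht => ?_
  rw [Pi.single_eq_of_ne (by simpa using ht), norm_zero]

theorem convFn_single_left {G : Type*} [Group G] (g : G) (f : G → ℂ) (x : G) :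
    convFn (Pi.single g 1) f x = f (g⁻¹ * x) := by
  unfold convFn
  rw [tsum_eq_single g fun s hs => by simp [hs]]
  simp

theorem convFn_single_right {G : Type*} [Group G] (g : G) (f : G → ℂ) (x : G) :
    convFn f (Pi.single g 1) x = f (x * g⁻¹) := by
  unfold convFn
  rw [tsum_eq_single (x * g⁻¹) fun s hs => ?_]
  · simp
  · rw [Pi.single_eq_of_ne, mul_zero]
    rintro rfl
    simp at hs

/-- A weak*-closed ideal is invariant under the conjugation action on functions. -/
theorem IsWStarClosedIdeal.conj_mem {G : Type*} [Group G] {I : Set (G → ℂ)}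
    (hI : IsWStarClosedIdeal I) {f : G → ℂ} (hf : f ∈ I) (g : G) :
    (fun x => f (g⁻¹ * x * g)) ∈ I := by
  obtain ⟨-, -, -, -, hmul, -⟩ := hI
  have h := (hmul _ (hmul f hf _ (memL1_single g)).1 _ (memL1_single g⁻¹)).2
  convert h using 1
  ext x
  rw [convFn_single_right, convFn_single_left, inv_inv, mul_assoc]

theorem MemC0.exists_norm_le {G : Type*} {φ : G → ℂ} (hφ : MemC0 φ) :
    ∃ C, ∀ t, ‖φ t‖ ≤ C := by
  have hfin : {t | ¬ ‖φ t‖ < 1}.Finite := by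
    have h := hφ.norm
    rw [norm_zero] at h
    exact h.eventually_lt_const zero_lt_one
  obtain ⟨C, hC⟩ := (hfin.image fun t => ‖φ t‖).bddAbove
  refine ⟨max C 1, fun t => ?_⟩
  by_cases ht : ‖φ t‖ < 1
  · exact ht.le.trans (le_max_right _ _)
  · exact (hC ⟨t, ht, rfl⟩).trans (le_max_left _ _)

/-- If `g K` centralizes the FC-elements of `K` and conjugates its other elements out of `K`,
then the `g K`-conjugates of `f` pair with `c₀` functions asymptotically like the restriction
of `f` to the FC-centre. -/
theorem tendsto_pairing_conj {G : Type*} [Group G] {f φ : G → ℂ} (hf : MemL1 f)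
    (hφ : MemC0 φ) (g : Finset G → G)
    (hfix : ∀ K, ∀ t ∈ K, t ∈ FCset G → g K * t * (g K)⁻¹ = t)
    (hmove : ∀ K, ∀ t ∈ K, t ∉ FCset G → g K * t * (g K)⁻¹ ∉ K) :
    Tendsto (fun K => ∑' t, φ t * f ((g K)⁻¹ * t * g K)) atTop
      (𝓝 (∑' t, φ t * (FCset G).indicator f t)) := by
  have hsum : ∀ K, ∑' t, φ t * f ((g K)⁻¹ * t * g K) =
      ∑' t, φ (g K * t * (g K)⁻¹) * f t := fun K => by
    rw [← (MulAut.conj (g K)).toEquiv.tsum_eq]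
    simp [mul_assoc]
  simp_rw [hsum]
  obtain ⟨C, hC⟩ := hφ.exists_norm_le
  refine tendsto_tsum_of_dominated_convergence (bound := fun t => C * ‖f t‖)
    (Summable.mul_left C hf) (fun t => ?_) (.of_forall fun K t => ?_)
  · have hmem : ∀ᶠ K : Finset G in atTop, t ∈ K :=
      (eventually_ge_atTop {t}).mono fun K hK => Finset.singleton_subset_iff.mp hK
    by_cases ht : t ∈ FCset G
    · refine tendsto_const_nhds.congr' (hmem.mono fun K hK => ?_)
      beta_reduce
      rw [hfix K t hK ht, Set.indicator_of_mem ht]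
    · rw [Set.indicator_of_notMem ht, mul_zero, ← zero_mul (f t)]
      refine Tendsto.mul_const _ (hφ.comp ?_)
      refine le_cofinite_iff_eventually_ne.mpr fun s => eventually_map.mpr ?_
      filter_upwards [hmem, eventually_ge_atTop {s}] with K hK hs heq
      exact hmove K t hK ht (heq ▸ Finset.singleton_subset_iff.mp hs)
  · rw [norm_mul]
    exact mul_le_mul_of_nonneg_right (hC _) (norm_nonneg _)

/-- **Lemma 5.5.** If `I` is a weak*-closed two-sided ideal of `ℓ¹(G)` and `f ∈ I`, then the
restriction of `f` to the FC-centre of `G` (extended by zero) also belongs to `I`. -/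
theorem restriction_to_FC_mem_ideal (G : Type*) [Group G] (I : Set (G → ℂ))
    (hI : IsWStarClosedIdeal I) (f : G → ℂ) (hf : f ∈ I) :
    (FCset G).indicator f ∈ I := by
  choose γ hγ using fun K : Finset G => exists_smul_eq_and_smul_notMem (Γ := ConjAct G) K
  have hfL1 : MemL1 f := hI.1 hf
  have hindL1 : MemL1 ((FCset G).indicator f) := by
    refine Summable.of_nonneg_of_le (fun _ => norm_nonneg _) (fun t => ?_) hfL1
    exact norm_indicator_le_norm_self f t
  have hclosed : IsClosed {f : L1 G | f.1 ∈ I} := hI.2.2.2.2.2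
  have hconj : ∀ K, (fun x => f ((ConjAct.ofConjAct (γ K))⁻¹ * x * ConjAct.ofConjAct (γ K))) ∈ I :=
    fun K => hI.conj_mem hf _
  let restr : L1 G := ⟨_, hindL1⟩
  let conj : Finset G → L1 G := fun K => ⟨_, hI.1 (hconj K)⟩
  suffices h : Tendsto conj atTop (𝓝 restr) from hclosed.mem_of_tendsto h (.of_forall hconj)
  rw [nhds_induced, tendsto_comap_iff, tendsto_pi_nhds]
  intro φ
  exact tendsto_pairing_conj hfL1 φ.2 (fun K => ConjAct.ofConjAct (γ K))
    (fun K t hK ht => (hγ K t hK).1 (mem_FCset_iff_finite_orbit.mp ht))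
    (fun K t hK ht => (hγ K t hK).2 (mt mem_FCset_iff_finite_orbit.mpr ht))
end
end
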